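/- arXiv:1207.0152 — 4 statements merged into one kernel-verified Lean document; each statement's English description precedes it below -/
import Mathlib

section
/- For every even positive integer b there exists a unique triple (m, l, p) with m, p natural numbers (including 0) and l a positive integer such that b = 2^(m+l+2) * p + 2^(m+1) * (2^l - 1). -/
theorem two_pow_mul_odd_inj {a c u v : ℕ} (hu : Odd u) (hv : Odd v)
    (h : 2 ^ a * u = 2 ^ c * v) : a = c ∧ u = v := by
  wlog hac : a ≤ c generalizing a c u v
  · obtain ⟨h₁, h₂⟩ := this hv hu h.symm (by omega)
    exact ⟨h₁.symm, h₂.symm⟩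
  obtain ⟨d, rfl⟩ := Nat.exists_eq_add_of_le hac
  rw [pow_add, mul_assoc] at h
  have huv : u = 2 ^ d * v := Nat.eq_of_mul_eq_mul_left (by positivity) h
  cases d with
  | zero => simpa using huv
  | succ d =>
    rw [huv, pow_succ] at hu
    exact absurd (Nat.odd_mul.1 (Nat.odd_mul.1 hu).1).2 (by decide)

theorem repr_eq_two_pow_mul (m l p : ℕ) :
    2 ^ (m + l + 2) * p + 2 ^ (m + 1) * (2 ^ l - 1) =
      2 ^ (m + 1) * (2 ^ l * (2 * p + 1) - 1) := by
  have h : 2 ^ l * (2 * p + 1) - 1 = 2 ^ (l + 1) * p + (2 ^ l - 1) := by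
    have := Nat.one_le_two_pow (n := l)
    rw [show 2 ^ l * (2 * p + 1) = 2 ^ (l + 1) * p + 2 ^ l by ring]
    omega
  rw [h]
  ring

theorem odd_two_pow_mul_sub_one {l : ℕ} (hl : 0 < l) (p : ℕ) :
    Odd (2 ^ l * (2 * p + 1) - 1) :=
  Nat.Even.sub_odd (Nat.one_le_iff_ne_zero.2 (by positivity))
    ((Nat.even_pow.2 ⟨even_two, hl.ne'⟩).mul_right _) odd_one

theorem even_unique_repr (b : ℕ) (hb : 0 < b) (heven : Even b) :
    ∃! t : ℕ × ℕ × ℕ, 0 < t.2.1 ∧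
      b = 2 ^ (t.1 + t.2.1 + 2) * t.2.2 + 2 ^ (t.1 + 1) * (2 ^ t.2.1 - 1) := by
  simp only [repr_eq_two_pow_mul]
  obtain ⟨k, c, hc, rfl⟩ := Nat.exists_eq_two_pow_mul_odd hb.ne'
  obtain ⟨l, d, hd, hcd⟩ := Nat.exists_eq_two_pow_mul_odd c.succ_ne_zero
  obtain ⟨p, rfl⟩ := hd
  have hk : k ≠ 0 := by
    rintro rfl
    exact Nat.not_even_iff_odd.2 hc (by simpa using heven)
  obtain ⟨m, rfl⟩ := Nat.exists_eq_succ_of_ne_zero hk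
  have hl : l ≠ 0 := by
    rintro rfl
    obtain ⟨j, rfl⟩ := hc
    omega
  refine ⟨(m, l, p), ⟨Nat.pos_of_ne_zero hl, ?_⟩, ?_⟩
  · simp [← hcd]
  · rintro ⟨m', l', p'⟩ ⟨hl', h⟩
    obtain ⟨hm, hc'⟩ := two_pow_mul_odd_inj hc (odd_two_pow_mul_sub_one hl' p') h
    have hpos : 0 < 2 ^ l' * (2 * p' + 1) := by positivity
    obtain ⟨hll, hp⟩ := two_pow_mul_odd_inj (a := l) (c := l') (odd_two_mul_add_one p)
      (odd_two_mul_add_one p') (by dsimp only at hc'; omega)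
    simp only [Prod.mk.injEq]
    dsimp only at hm
    omega
end

section
/- For every positive integer a, the unique representation of the power of two 2^a in the form 2^(m+l+2) * p + 2^(m+1) * (2^l - 1) with m, p ≥ 0 and l ≥ 1 has p = 0, l = 1, and m = a - 1; that is, if 2^(m+l+2) * p + 2^(m+1) * (2^l - 1) = 2^a with l ≥ 1, then p = 0, l = 1 and m + 1 = a. -/
theorem pow_two_repr (a m l p : ℕ) (ha : 0 < a) (hl : 1 ≤ l)
    (h : 2 ^ (m + l + 2) * p + 2 ^ (m + 1) * (2 ^ l - 1) = 2 ^ a) :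
    p = 0 ∧ l = 1 ∧ m + 1 = a := by
  obtain ⟨n, rfl⟩ := Nat.exists_eq_add_of_le' hl
  have hn : 0 < 2 ^ n := by positivity
  have hfac : 2 ^ (m + 1) * (2 ^ (n + 2) * p + (2 ^ (n + 1) - 1)) = 2 ^ a := by
    rw [← h]
    ring
  -- The second factor is an odd divisor of a power of two.
  have hodd : Odd (2 ^ (n + 2) * p + (2 ^ (n + 1) - 1)) :=
    ⟨2 ^ (n + 1) * p + (2 ^ n - 1), by
      rw [pow_succ 2 (n + 1), mul_right_comm, pow_succ 2 n]
      omega⟩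
  have hone : 2 ^ (n + 2) * p + (2 ^ (n + 1) - 1) = 1 :=
    (hodd.coprime_two_right.pow_right a).eq_one_of_dvd (Dvd.intro_left _ hfac)
  have hp : p = 0 := by
    by_contra hp
    have hle : 2 ^ (n + 2) ≤ 2 ^ (n + 2) * p := Nat.le_mul_of_pos_right _ (Nat.pos_of_ne_zero hp)
    have hpow : 2 ^ (n + 2) = 4 * 2 ^ n := by ring
    linarith [Nat.zero_le (2 ^ (n + 1) - 1)]
  subst hp
  have hn0 : n = 0 := by
    have : 2 ^ n = 1 := by omega
    simpa using this
  rw [hone, mul_one] at hfac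
  exact ⟨rfl, by rw [hn0], Nat.pow_right_injective le_rfl hfac⟩
end

section
/- For all natural numbers k, p and every natural number j with j ≤ k + 1, the j-th iterate of the map T(x) = (3x + 1)/2 applied to the number n = 2^(k+2) * p + 2^(k+1) - 1 equals 3^j * 2^(k+2-j) * p + 3^j * 2^(k+1-j) - 1. -/
theorem iterate_shortcut_two_pow_mul_sub_one (j m : ℕ) (hm : 0 < m) :
    (fun x : ℕ => (3 * x + 1) / 2)^[j] (2 ^ j * m - 1) = 3 ^ j * m - 1 := by
  induction j generalizing m with
  | zero => simp
  | succ j ih =>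
    have step : (3 * (2 ^ (j + 1) * m - 1) + 1) / 2 = 2 ^ j * (3 * m) - 1 := by
      have hpos : 0 < 2 ^ j * m := by positivity
      rw [show 2 ^ (j + 1) * m = 2 * (2 ^ j * m) by ring,
        show 2 ^ j * (3 * m) = 3 * (2 ^ j * m) by ring]
      omega
    rw [Function.iterate_succ_apply, step, ih (3 * m) (by positivity), pow_succ, mul_assoc]

theorem collatz_shortcut_iterate (k p j : ℕ) (hj : j ≤ k + 1) :
    (fun x : ℕ => (3 * x + 1) / 2)^[j] (2 ^ (k + 2) * p + 2 ^ (k + 1) - 1) =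
      3 ^ j * 2 ^ (k + 2 - j) * p + 3 ^ j * 2 ^ (k + 1 - j) - 1 := by
  have h := iterate_shortcut_two_pow_mul_sub_one j
    (2 ^ (k + 2 - j) * p + 2 ^ (k + 1 - j)) (by positivity)
  rwa [mul_add, mul_add, ← mul_assoc, ← mul_assoc, pow_mul_pow_sub 2 (by omega : j ≤ k + 2),
    pow_mul_pow_sub 2 hj] at h
end

section
/- For all natural numbers k, p and every j ≤ k, the j-th iterate of T(x) = (3x + 1)/2 applied to 2^(k+2) * p + 2^(k+1) - 1 equals 2^((k-j)+2) * (3^j * p + (3^j - 1)/2) + 2^((k-j)+1) - 1; that is, after j applications the number is the member of the fixed odd subsequence of order k - j at position 3^j * p + (3^j - 1)/2. In particular, after k applications the result is 4 * (3^k * p + (3^k - 1)/2) + 1, a member of EO. -/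
theorem collatz_shortcut_fixed_odd_step (m q : ℕ) :
    (3 * (2 ^ (m + 1 + 2) * q + 2 ^ (m + 1 + 1) - 1) + 1) / 2 =
      2 ^ (m + 2) * (3 * q + 1) + 2 ^ (m + 1) - 1 := by
  have ha : 0 < 2 ^ m := by positivity
  simp only [pow_succ, mul_add]
  generalize 2 ^ m = a at *
  have h₁ : a * 2 * 2 * 2 * q = 8 * (a * q) := by ring
  have h₂ : a * 2 * 2 * (3 * q) = 12 * (a * q) := by ring
  rw [h₁, h₂]
  omega

theorem three_pow_succ_sub_one_half (j : ℕ) :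
    (3 ^ (j + 1) - 1) / 2 = 3 * ((3 ^ j - 1) / 2) + 1 := by
  obtain ⟨c, hc⟩ : Odd (3 ^ j) := Odd.pow (by decide)
  omega

theorem collatz_shortcut_iterate_fixed_odd (m p j : ℕ) :
    (fun x : ℕ => (3 * x + 1) / 2)^[j] (2 ^ (m + j + 2) * p + 2 ^ (m + j + 1) - 1) =
      2 ^ (m + 2) * (3 ^ j * p + (3 ^ j - 1) / 2) + 2 ^ (m + 1) - 1 := by
  induction j generalizing m with
  | zero => simp
  | succ j ih =>
    rw [Function.iterate_succ_apply', show m + (j + 1) = m + 1 + j by ring, ih,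
      collatz_shortcut_fixed_odd_step, three_pow_succ_sub_one_half,
      show 3 * (3 ^ j * p + (3 ^ j - 1) / 2) + 1 =
        3 ^ (j + 1) * p + (3 * ((3 ^ j - 1) / 2) + 1) by ring]

theorem collatz_shortcut_iterate_position (k p : ℕ) :
    (∀ j ≤ k,
      (fun x : ℕ => (3 * x + 1) / 2)^[j] (2 ^ (k + 2) * p + 2 ^ (k + 1) - 1) =
        2 ^ ((k - j) + 2) * (3 ^ j * p + (3 ^ j - 1) / 2) + 2 ^ ((k - j) + 1) - 1) ∧
      (fun x : ℕ => (3 * x + 1) / 2)^[k] (2 ^ (k + 2) * p + 2 ^ (k + 1) - 1) =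
        4 * (3 ^ k * p + (3 ^ k - 1) / 2) + 1 := by
  constructor
  · intro j hj
    simpa only [Nat.sub_add_cancel hj] using collatz_shortcut_iterate_fixed_odd (k - j) p j
  · simpa using collatz_shortcut_iterate_fixed_odd 0 p k
end
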